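/- Every finitely generated metabelian group is residually finite. -/

import Mathlib

/-- The ring of integers is a Jacobson ring. -/
theorem Int.isJacobsonRing : IsJacobsonRing ℤ := by
  rw [isJacobsonRing_iff_prime_eq]
  intro P hP
  by_cases h0 : P = ⊥
  · subst h0
    rw [eq_bot_iff]
    intro x hx
    have h := Ideal.mem_jacobson_bot.mp hx x
    rw [Int.isUnit_iff] at h
    rw [Ideal.mem_bot]
    rcases h with h | h <;> nlinarith [mul_self_nonneg x]
  · have := hP.isMaximal h0
    exact Ideal.jacobson_eq_self_of_isMaximal

/-- A field which is finitely generated as a ring is finite. -/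
theorem Field.finite_of_finiteType_int (K : Type*) [Field K] [Algebra.FiniteType ℤ K] :
    Finite K := by
  have := Int.isJacobsonRing
  have hfin : Module.Finite ℤ K := finite_of_finite_type_of_isJacobsonRing ℤ K
  have hinj : ¬ Function.Injective (algebraMap ℤ K) := fun h ↦
    have : FaithfulSMul ℤ K := (faithfulSMul_iff_algebraMap_injective ℤ K).mpr h
    Int.not_isField ((Algebra.IsIntegral.isField_iff_isField h).mpr (Field.toIsField K))
  rw [injective_iff_map_eq_zero] at hinj
  push Not at hinj
  obtain ⟨n, hn, hn0⟩ := hinj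
  refine Module.finite_of_fg_torsion K fun {x} ↦ ⟨⟨n, mem_nonZeroDivisors_of_ne_zero hn0⟩, ?_⟩
  change n • x = 0
  rw [Algebra.smul_def, hn, zero_mul]

/-- A finitely generated module over a finitely generated commutative ring is residually finite. -/
theorem Submodule.exists_finite_quotient_notMem {R M : Type*} [CommRing R]
    [Algebra.FiniteType ℤ R] [AddCommGroup M] [Module R M] [Module.Finite R M]
    {m : M} (hm : m ≠ 0) : ∃ N : Submodule R M, m ∉ N ∧ Finite (M ⧸ N) := by
  have : IsNoetherianRing R := Algebra.FiniteType.isNoetherianRing ℤ R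
  have hann : LinearMap.ker (LinearMap.toSpanSingleton R M m) ≠ ⊤ := fun h ↦ hm <| by
    have : (1 : R) ∈ LinearMap.ker (LinearMap.toSpanSingleton R M m) := h ▸ Submodule.mem_top
    simpa using this
  obtain ⟨I, hI, hle⟩ := Ideal.exists_le_maximal _ hann
  have hnot : m ∉ (⨅ i : ℕ, I ^ i • ⊤ : Submodule R M) := fun h ↦ by
    obtain ⟨r, hr⟩ := (I.mem_iInf_smul_pow_eq_bot_iff m).mp h
    have h1 : 1 - (r : R) ∈ I := hle (by simp [sub_smul, hr])
    exact hI.ne_top ((Ideal.eq_top_iff_one I).mpr (by simpa using I.add_mem h1 r.2))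
  rw [Submodule.mem_iInf] at hnot
  push Not at hnot
  obtain ⟨k, hk⟩ := hnot
  have : Finite (R ⧸ I) :=
    letI := Ideal.Quotient.field I
    have : @Algebra.FiniteType ℤ (R ⧸ I) _ _ (Ring.toIntAlgebra _) :=
      .of_surjective (Ideal.Quotient.mk I).toIntAlgHom Ideal.Quotient.mk_surjective
    Field.finite_of_finiteType_int (R ⧸ I)
  have : Finite (R ⧸ I ^ k) := Ideal.finite_quotient_pow (IsNoetherian.noetherian I) k
  have : Module.Finite (R ⧸ I ^ k) (M ⧸ (I ^ k • ⊤ : Submodule R M)) :=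
    Module.Finite.of_restrictScalars_finite R _ _
  exact ⟨_, hk, Module.finite_of_finite (R ⧸ I ^ k)⟩

/-- A finitely generated abelian group is residually finite. -/
theorem CommGroup.residuallyFinite_of_fg (G : Type*) [CommGroup G] [Group.FG G] :
    Group.ResiduallyFinite G := by
  rw [Group.residuallyFinite_iff_exists_finiteIndex]
  intro g hg
  have : Module.Finite ℤ (Additive G) := Module.Finite.iff_addGroup_fg.mpr inferInstance
  obtain ⟨N, hN, hfin⟩ := Submodule.exists_finite_quotient_notMem (R := ℤ) (M := Additive G)
    (m := Additive.ofMul g) hg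
  have hN' : N.toAddSubgroup.FiniteIndex :=
    have : Finite (Additive G ⧸ N.toAddSubgroup) := hfin
    AddSubgroup.finiteIndex_of_finite_quotient
  refine ⟨AddSubgroup.toSubgroup' N.toAddSubgroup, ⟨?_⟩, hN⟩
  exact hN'.index_ne_zero

/-- A group with a residually finite subgroup of finite index is residually finite. -/
theorem Group.ResiduallyFinite.of_finiteIndex {G : Type*} [Group G] (H : Subgroup G)
    [H.FiniteIndex] [Group.ResiduallyFinite H] : Group.ResiduallyFinite G := by
  rw [Group.residuallyFinite_iff_exists_finiteIndex]
  intro g hg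
  by_cases hgH : g ∈ H
  · obtain ⟨K, hK, hgK⟩ := Group.residuallyFinite_iff_exists_finiteIndex.mp ‹_›
      (⟨g, hgH⟩ : H) (by simpa [Subtype.ext_iff] using hg)
    refine ⟨K.map H.subtype, ⟨?_⟩, by simpa [hgH] using hgK⟩
    rw [Subgroup.index_map_subtype]
    exact mul_ne_zero hK.index_ne_zero Subgroup.FiniteIndex.index_ne_zero
  · exact ⟨H, inferInstance, hgH⟩

section

open scoped commutatorElement IsMulCommutative

/-- A finitely generated group with finitely many commutators is residually finite. -/
theorem Group.residuallyFinite_of_finite_commutatorSet (G : Type*) [Group G] [Group.FG G]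
    [Finite (commutatorSet G)] : Group.ResiduallyFinite G :=
  have := CommGroup.residuallyFinite_of_fg (Subgroup.center G)
  .of_finiteIndex (Subgroup.center G)

/-- If the pairwise commutators of a generating set lie in a normal subgroup, then that subgroup
contains the commutator subgroup. -/
theorem commutator_le_of_closure_eq_top {G : Type*} [Group G] {S : Set G}
    (hS : Subgroup.closure S = ⊤) (N : Subgroup G) [N.Normal]
    (h : ∀ s ∈ S, ∀ t ∈ S, ⁅s, t⁆ ∈ N) : commutator G ≤ N := by
  have key (x y : G) : ⁅x, y⁆ ∈ N ↔ Commute (x : G ⧸ N) (y : G ⧸ N) := by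
    rw [← commutatorElement_eq_one_iff_commute, ← QuotientGroup.eq_one_iff]
    rfl
  rw [commutator_def, Subgroup.commutator_le]
  rintro x - y -
  have hx : x ∈ Subgroup.closure S := hS ▸ Subgroup.mem_top x
  have hy : y ∈ Subgroup.closure S := hS ▸ Subgroup.mem_top y
  rw [key]
  induction hx, hy using Subgroup.closure_induction₂ with
  | mem x y hx hy => exact (key x y).mp (h x hx y hy)
  | one_left x => exact Commute.one_left _
  | one_right x => exact Commute.one_right _
  | mul_left x y z _ _ _ h₁ h₂ => exact h₁.mul_left h₂
  | mul_right x y z _ _ _ h₁ h₂ => exact h₁.mul_right h₂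
  | inv_left x y _ _ h => exact h.inv_left
  | inv_right x y _ _ h => exact h.inv_right

variable {G : Type*} [Group G] [IsMulCommutative (commutator G)]

/-- The conjugation action of `G` on its abelian commutator subgroup, written additively. -/
def commutatorConj : G →* Module.End ℤ (Additive (commutator G)) where
  toFun g := (MonoidHom.toAdditive (MulAut.conjNormal g).toMonoidHom).toIntLinearMap
  map_one' := by ext; simp
  map_mul' x y := by ext; simp

/-- The conjugation action of the abelianization of `G` on the commutator subgroup of `G`. -/
def abelianizationConj : Abelianization G →* Module.End ℤ (Additive (commutator G)) :=
  QuotientGroup.lift (commutator G) commutatorConj fun g hg ↦ by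
    ext x
    change g * x.toMul * g⁻¹ = x.toMul
    have h : (⟨g, hg⟩ : commutator G) * x.toMul = x.toMul * ⟨g, hg⟩ := mul_comm' _ _
    rw [mul_inv_eq_iff_eq_mul]
    exact congrArg Subtype.val h

/-- The commutator subgroup of a metabelian group is a module over the integral group ring of the
abelianization. -/
noncomputable instance commutatorModule :
    Module (MonoidAlgebra ℤ (Abelianization G)) (Additive (commutator G)) :=
  Module.compHom _ (MonoidAlgebra.lift ℤ _ _ abelianizationConj).toRingHom

theorem coe_single_smul (g : G) (x : Additive (commutator G)) :
    (((MonoidAlgebra.single (Abelianization.of g) (1 : ℤ)) • x).toMul : G) =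
      g * x.toMul * g⁻¹ := by
  change ((MonoidAlgebra.lift ℤ _ _ abelianizationConj
    (MonoidAlgebra.single (Abelianization.of g) (1 : ℤ)) x).toMul : G) = _
  rw [MonoidAlgebra.lift_single, one_smul]
  rfl

/-- The subgroup of `G` underlying a submodule of its commutator subgroup. -/
noncomputable def commutatorSubmoduleToSubgroup
    (N : Submodule (MonoidAlgebra ℤ (Abelianization G)) (Additive (commutator G))) : Subgroup G :=
  (AddSubgroup.toSubgroup' N.toAddSubgroup).map (commutator G).subtype

theorem mem_commutatorSubmoduleToSubgroup
    {N : Submodule (MonoidAlgebra ℤ (Abelianization G)) (Additive (commutator G))}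
    (x : commutator G) :
    (x : G) ∈ commutatorSubmoduleToSubgroup N ↔ Additive.ofMul x ∈ N :=
  Subgroup.mem_map_iff_mem (commutator G).subtype_injective

instance (N : Submodule (MonoidAlgebra ℤ (Abelianization G)) (Additive (commutator G))) :
    (commutatorSubmoduleToSubgroup N).Normal where
  conj_mem := by
    rintro _ ⟨x, hx, rfl⟩ g
    exact ⟨_, N.smul_mem (MonoidAlgebra.single (Abelianization.of g) 1) hx,
      coe_single_smul g (Additive.ofMul x)⟩

instance [Group.FG G] :
    Module.Finite (MonoidAlgebra ℤ (Abelianization G)) (Additive (commutator G)) := by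
  obtain ⟨S, hS⟩ := Group.FG.out (G := G)
  let c (p : S × S) : commutator G :=
    ⟨⁅(p.1 : G), (p.2 : G)⁆,
      Subgroup.commutator_mem_commutator (Subgroup.mem_top _) (Subgroup.mem_top _)⟩
  refine Module.Finite.of_fg_top (Submodule.fg_def.mpr
    ⟨Set.range fun p ↦ Additive.ofMul (c p), Set.finite_range _, ?_⟩)
  rw [eq_top_iff]
  intro x _
  refine (mem_commutatorSubmoduleToSubgroup x.toMul).mp
    (commutator_le_of_closure_eq_top hS _ (fun s hs t ht ↦ ?_) x.toMul.2)
  exact (mem_commutatorSubmoduleToSubgroup (c (⟨s, hs⟩, ⟨t, ht⟩))).mpr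
    (Submodule.subset_span ⟨_, rfl⟩)

theorem finite_commutatorSet_quotient
    (N : Submodule (MonoidAlgebra ℤ (Abelianization G)) (Additive (commutator G)))
    [Finite (Additive (commutator G) ⧸ N)] :
    Finite (commutatorSet (G ⧸ commutatorSubmoduleToSubgroup N)) := by
  let f (q : Additive (commutator G) ⧸ N) : G ⧸ commutatorSubmoduleToSubgroup N :=
    ((q.out.toMul : commutator G) : G)
  refine ((Set.finite_range f).subset ?_).to_subtype
  rintro _ ⟨x, y, rfl⟩
  induction x using QuotientGroup.induction_on with | H x =>
  induction y using QuotientGroup.induction_on with | H y =>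
  let c : commutator G :=
    ⟨⁅x, y⁆, Subgroup.commutator_mem_commutator (Subgroup.mem_top _) (Subgroup.mem_top _)⟩
  refine ⟨Submodule.Quotient.mk (Additive.ofMul c), QuotientGroup.eq.mpr ?_⟩
  refine (mem_commutatorSubmoduleToSubgroup
    ((Submodule.Quotient.mk (p := N) (Additive.ofMul c)).out.toMul⁻¹ * c)).mpr ?_
  rw [ofMul_mul, ofMul_inv, ofMul_toMul, neg_add_eq_sub, ← Submodule.Quotient.eq]
  exact (Quotient.out_eq _).symm

variable (G) in
/-- P. Hall's theorem. -/
theorem Group.residuallyFinite_of_metabelian [Group.FG G] : Group.ResiduallyFinite G := by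
  have key (K : Subgroup G) [K.Normal] [Finite (commutatorSet (G ⧸ K))] (g : G) (hg : g ∉ K) :
      ∃ H : Subgroup G, H.FiniteIndex ∧ g ∉ H := by
    have := Group.residuallyFinite_of_finite_commutatorSet (G ⧸ K)
    obtain ⟨H, hH, hgH⟩ := Group.residuallyFinite_iff_exists_finiteIndex.mp this
      (g : G ⧸ K) (by rwa [Ne, QuotientGroup.eq_one_iff])
    refine ⟨H.comap (QuotientGroup.mk' K), ⟨?_⟩, hgH⟩
    rw [H.index_comap_of_surjective (QuotientGroup.mk'_surjective K)]
    exact hH.index_ne_zero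
  rw [Group.residuallyFinite_iff_exists_finiteIndex]
  intro g hg
  by_cases hgA : g ∈ commutator G
  · have : Group.FG (Abelianization G) := QuotientGroup.fg (commutator G)
    have : @Algebra.FiniteType ℤ (MonoidAlgebra ℤ (Abelianization G)) _ _
        (Ring.toIntAlgebra _) :=
      (MonoidAlgebra.finiteType_of_fg (R := ℤ) (M := Abelianization G)).of_surjective
        (RingHom.id _).toIntAlgHom Function.surjective_id
    obtain ⟨N, hN, _⟩ := Submodule.exists_finite_quotient_notMem
      (R := MonoidAlgebra ℤ (Abelianization G)) (M := Additive (commutator G))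
      (m := Additive.ofMul ⟨g, hgA⟩) fun h ↦ hg (congrArg (fun x ↦ (x.toMul : G)) h)
    have := finite_commutatorSet_quotient N
    exact key _ g (mt (mem_commutatorSubmoduleToSubgroup ⟨g, hgA⟩).mp hN)
  · have : Finite (commutatorSet (G ⧸ commutator G)) := by
      refine ((Set.finite_singleton 1).subset ?_).to_subtype
      rintro _ ⟨x, y, rfl⟩
      exact commutatorElement_eq_one_iff_mul_comm.mpr
        (mul_comm (G := Abelianization G) x y)
    exact key _ g hgA

end

/-- P. Hall's theorem: every finitely generated metabelian group is residually finite.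
Metabelian means the commutator subgroup is abelian; residually finite means every
non-trivial element survives in some finite quotient. -/
theorem stmt_8 (G : Type) [Group G] [Group.FG G]
    (hmeta : ∀ x y : G, x ∈ commutator G → y ∈ commutator G → x * y = y * x) :
    ∀ g : G, g ≠ 1 →
      ∃ (F : Type) (_ : Group F) (_ : Finite F) (γ : G →* F), γ g ≠ 1 := by
  intro g hg
  have : IsMulCommutative (commutator G) := ⟨⟨fun x y ↦ Subtype.ext (hmeta x y x.2 y.2)⟩⟩
  have := Group.residuallyFinite_of_metabelian G
  obtain ⟨H, hH⟩ := Group.exists_finiteIndexNormalSubgroup_notMem g hg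
  exact ⟨G ⧸ H.toSubgroup, inferInstance, inferInstance, QuotientGroup.mk' H.toSubgroup,
    mt (QuotientGroup.eq_one_iff g).mp hH⟩
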